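/- For every measurable space 𝒳, every probability distribution D over 𝒳×{0,1}, and every measurable predictor f:𝒳→[0,1], it holds that ldCE_D(f) ≤ dCE_D(f) ≤ udCE_D(f). -/

import Mathlib

open MeasureTheory Set

noncomputable section

/-- The unit interval `[0,1]` as a type. -/
abbrev I01 : Type := unitInterval

/-- The real value of a Boolean label. -/
def lbl (y : Bool) : ℝ := if y then 1 else 0

/-- The calibration correlation `E_{(v,y)∼Γ}[(y − v)·w(v)]` against a weight function `w`. -/
def calErr (Γ : Measure (I01 × Bool)) (w : I01 → ℝ) : ℝ :=
  ∫ p, (lbl p.2 - (p.1 : ℝ)) * w p.1 ∂Γ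

/-- A prediction-label distribution `Γ` on `[0,1] × {0,1}` is perfectly calibrated iff
`E[(y − v)·w(v)] = 0` for every bounded measurable weight function `w`. -/
def PerfCal (Γ : Measure (I01 × Bool)) : Prop :=
  ∀ w : I01 → ℝ, Measurable w → (∃ C : ℝ, ∀ t, |w t| ≤ C) → calErr Γ w = 0

/-- `ext(Γ)`: couplings `Π` of triples `(u,v,y)` whose `(v,y)`-marginal is `Γ` and whose
`(u,y)`-marginal is perfectly calibrated. -/
def extSet (Γ : Measure (I01 × Bool)) : Set (Measure (I01 × I01 × Bool)) :=
  {π | IsProbabilityMeasure π ∧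
    π.map (fun p => (p.2.1, p.2.2)) = Γ ∧
    PerfCal (π.map (fun p => (p.1, p.2.2)))}

/-- The lower distance to calibration `ldCE(Γ)`. -/
def ldCE (Γ : Measure (I01 × Bool)) : ℝ :=
  sInf {x | ∃ π ∈ extSet Γ, x = ∫ p, |(p.1 : ℝ) - (p.2.1 : ℝ)| ∂π}

/-- The upper distance to calibration `udCE(Γ)`: distance to calibration via post-processing. -/
def udCE (Γ : Measure (I01 × Bool)) : ℝ :=
  sInf {x | ∃ κ : I01 → I01, Measurable κ ∧
    PerfCal (Γ.map (fun p => (κ p.1, p.2))) ∧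
    x = ∫ p, |(p.1 : ℝ) - (κ p.1 : ℝ)| ∂Γ}

/-- The smooth calibration error `smCE(Γ)`: supremum of `E[(y−v)w(v)]` over `1`-Lipschitz
weight functions `w : [0,1] → [−1,1]`. -/
def smCE (Γ : Measure (I01 × Bool)) : ℝ :=
  sSup {x | ∃ w : I01 → ℝ, LipschitzWith 1 w ∧ (∀ t, |w t| ≤ 1) ∧ x = calErr Γ w}

/-- The prediction-label distribution `D_f` induced by a predictor `f`. -/
def predDist {𝒳 : Type*} [MeasurableSpace 𝒳] (D : Measure (𝒳 × Bool)) (f : 𝒳 → I01) :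
    Measure (I01 × Bool) :=
  D.map (fun p => (f p.1, p.2))

/-- `cal(D)`: the set of measurable predictors that are perfectly calibrated w.r.t. `D`. -/
def calSet {𝒳 : Type*} [MeasurableSpace 𝒳] (D : Measure (𝒳 × Bool)) : Set (𝒳 → I01) :=
  {g | Measurable g ∧ PerfCal (predDist D g)}

/-- The true (ℓ₁) distance to calibration `dCE_D(f)`. -/
def dCE {𝒳 : Type*} [MeasurableSpace 𝒳] (D : Measure (𝒳 × Bool)) (f : 𝒳 → I01) : ℝ :=
  sInf {x | ∃ g ∈ calSet D, x = ∫ p, |(f p.1 : ℝ) - (g p.1 : ℝ)| ∂D}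

/-- A finite partition of `[0,1]` into (order-convex) intervals. -/
structure IntervalPartition where
  m : ℕ
  piece : Fin m → Set ℝ
  ordConn : ∀ j, (piece j).OrdConnected
  disj : ∀ i j, i ≠ j → Disjoint (piece i) (piece j)
  cover : (⋃ j, piece j) = Set.Icc (0 : ℝ) 1

/-- `binnedECE(Γ, 𝓘) = Σ_j |E[(v − y)·1(v ∈ I_j)]|`. -/
def binnedECE (Γ : Measure (I01 × Bool)) (P : IntervalPartition) : ℝ :=
  ∑ j : Fin P.m,
    |∫ p, Set.indicator (P.piece j) (fun _ => ((p.1 : ℝ) - lbl p.2)) (p.1 : ℝ) ∂Γ|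

/-- The average interval width `w_Γ(𝓘) = Σ_j E[1(v ∈ I_j)]·w(I_j)`. -/
def avgWidth (Γ : Measure (I01 × Bool)) (P : IntervalPartition) : ℝ :=
  ∑ j : Fin P.m,
    (∫ p, Set.indicator (P.piece j) (fun _ => (1 : ℝ)) (p.1 : ℝ) ∂Γ) * Metric.diam (P.piece j)

/-- The interval calibration error `intCE(Γ)`. -/
def intCE (Γ : Measure (I01 × Bool)) : ℝ :=
  sInf {x | ∃ P : IntervalPartition, x = binnedECE Γ P + avgWidth Γ P}

/-- The random interval calibration error `RintCE(Γ, ε)`, with `r` uniform on `[0, ε)` and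
intervals `I^ε_{r,j} = [r + jε, r + (j+1)ε)`. -/
def RintCE (Γ : Measure (I01 × Bool)) (ε : ℝ) : ℝ :=
  (1 / ε) * ∫ r in Set.Ico (0 : ℝ) ε,
    ∑' j : ℤ, |∫ p, Set.indicator (Set.Ico (r + (j : ℝ) * ε) (r + ((j : ℝ) + 1) * ε))
      (fun _ => (lbl p.2 - (p.1 : ℝ))) (p.1 : ℝ) ∂Γ|

/-- The surrogate interval calibration error `SintCE(Γ)`. -/
def SintCE (Γ : Measure (I01 × Bool)) : ℝ :=
  ⨅ k : ℕ, (RintCE Γ ((1 / 2) ^ k) + (1 / 2) ^ k)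

/-- The squared Laplace-kernel calibration error:
`K_Lap(Γ) = E[(y−v)(y′−v′)·exp(−|v−v′|)]` over two independent samples from `Γ`. -/
def KLap (Γ : Measure (I01 × Bool)) : ℝ :=
  ∫ q, (lbl q.1.2 - (q.1.1 : ℝ)) * (lbl q.2.2 - (q.2.1 : ℝ)) *
    Real.exp (-|(q.1.1 : ℝ) - (q.2.1 : ℝ)|) ∂(Γ.prod Γ)

/-- The squared Gaussian-kernel calibration error:
`K_Gauss(Γ) = E[(y−v)(y′−v′)·exp(−(v−v′)²)]` over two independent samples from `Γ`. -/
def KGauss (Γ : Measure (I01 × Bool)) : ℝ :=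
  ∫ q, (lbl q.1.2 - (q.1.1 : ℝ)) * (lbl q.2.2 - (q.2.1 : ℝ)) *
    Real.exp (-(((q.1.1 : ℝ) - (q.2.1 : ℝ)) ^ 2)) ∂(Γ.prod Γ)

theorem lbl_measurable : Measurable lbl := measurable_from_top

theorem PerfCal_const (Γ : Measure (I01 × Bool)) [IsProbabilityMeasure Γ] :
    ∃ c : I01, PerfCal (Γ.map (fun p => (c, p.2))) := by
  have hl : Measurable (fun p : I01 × Bool => lbl p.2) := lbl_measurable.comp measurable_snd
  have h01 : ∀ y, 0 ≤ lbl y ∧ lbl y ≤ 1 := by intro y; cases y <;> simp [lbl]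
  have hi : Integrable (fun p : I01 × Bool => lbl p.2) Γ := by
    refine Integrable.of_bound hl.aestronglyMeasurable 1 (Filter.Eventually.of_forall fun p => ?_)
    rw [Real.norm_eq_abs, abs_le]
    constructor <;> linarith [(h01 p.2).1, (h01 p.2).2]
  have h0 : 0 ≤ ∫ p, lbl p.2 ∂Γ := integral_nonneg fun p => (h01 p.2).1
  have h1 : ∫ p, lbl p.2 ∂Γ ≤ 1 := by
    have := integral_mono hi (integrable_const (1 : ℝ)) fun p => (h01 p.2).2
    simpa using this
  refine ⟨⟨∫ p, lbl p.2 ∂Γ, h0, h1⟩, fun w hw _ => ?_⟩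
  unfold calErr
  have hm : Measurable (fun p : I01 × Bool => (lbl p.2 - (p.1 : ℝ)) * w p.1) :=
    (hl.sub (measurable_subtype_coe.comp measurable_fst)).mul (hw.comp measurable_fst)
  rw [integral_map (by fun_prop) hm.aestronglyMeasurable]
  simp only
  rw [integral_mul_const, integral_sub hi (integrable_const _)]
  simp

/-- `ldCE_D(f) ≤ dCE_D(f) ≤ udCE_D(f)`. -/
theorem ldCE_le_dCE_le_udCE {𝒳 : Type*} [MeasurableSpace 𝒳]
    (D : Measure (𝒳 × Bool)) [IsProbabilityMeasure D] (f : 𝒳 → I01) (hf : Measurable f) :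
    ldCE (predDist D f) ≤ dCE D f ∧ dCE D f ≤ udCE (predDist D f) := by
  have hF : Measurable (fun p : 𝒳 × Bool => (f p.1, p.2)) := by fun_prop
  haveI : IsProbabilityMeasure (predDist D f) := Measure.isProbabilityMeasure_map hF.aemeasurable
  have hκ : ∀ κ : I01 → I01, Measurable κ →
      PerfCal ((predDist D f).map (fun p => (κ p.1, p.2))) → (fun x => κ (f x)) ∈ calSet D := by
    intro κ hκ h
    refine ⟨hκ.comp hf, ?_⟩
    unfold predDist at h ⊢
    rwa [Measure.map_map (by fun_prop) hF] at h
  obtain ⟨c, hc⟩ := PerfCal_const (predDist D f)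
  constructor
  · refine csInf_le_csInf ⟨0, ?_⟩ ⟨_, _, hκ (fun _ => c) measurable_const hc, rfl⟩ ?_
    · rintro x ⟨π, -, rfl⟩
      exact integral_nonneg fun p => abs_nonneg _
    · rintro x ⟨g, ⟨hg, hcal⟩, rfl⟩
      have hG : Measurable (fun p : 𝒳 × Bool => (g p.1, f p.1, p.2)) := by fun_prop
      refine ⟨D.map (fun p => (g p.1, f p.1, p.2)),
        ⟨Measure.isProbabilityMeasure_map hG.aemeasurable, ?_, ?_⟩, ?_⟩
      · rw [Measure.map_map (by fun_prop) hG]; rfl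
      · rw [Measure.map_map (by fun_prop) hG]; exact hcal
      · rw [integral_map hG.aemeasurable
          (by apply Measurable.aestronglyMeasurable; fun_prop)]
        simp only [abs_sub_comm]
  · refine csInf_le_csInf ⟨0, ?_⟩ ⟨_, fun _ => c, measurable_const, hc, rfl⟩ ?_
    · rintro x ⟨g, -, rfl⟩
      exact integral_nonneg fun p => abs_nonneg _
    · rintro x ⟨κ, hk, hcal, rfl⟩
      refine ⟨_, hκ κ hk hcal, ?_⟩
      unfold predDist
      rw [integral_map hF.aemeasurable
          (by apply Measurable.aestronglyMeasurable; fun_prop)]
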